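/- (Šneider) There is a constant C > 0 such that limsup_{n→∞} D_n^κ(x)/log n ≥ C for almost every x ∈ G. -/

import Mathlib

open MeasureTheory Filter Finset ENNReal

noncomputable section

/-- The Walsh group `G`: countable product of copies of `ℤ/2ℤ`. -/
abbrev WG : Type := ℕ → ZMod 2

/-- The normalized Haar measure (= product of uniform coin-toss measures) on `G`. -/
def μW : Measure WG := Measure.addHaarMeasure ⊤

instance : (μW).Regular := by unfold μW; infer_instance

instance : IsFiniteMeasure μW := by
  constructor
  rw [← TopologicalSpace.PositiveCompacts.coe_top (α := WG)]
  exact IsCompact.measure_lt_top (⊤ : TopologicalSpace.PositiveCompacts WG).isCompact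

/-- The product measure on `G^d`. -/
def μD (d : ℕ) : Measure (Fin d → WG) := Measure.pi fun _ => μW

/-- The `k`-th Rademacher function. -/
def rad (k : ℕ) (x : WG) : ℝ := (-1 : ℝ) ^ (x k).val

/-- The Walsh–Paley function of index `n`. -/
def walsh (n : ℕ) (x : WG) : ℝ :=
  ∏ k ∈ Finset.range n.size, if n.testBit k then rad k x else 1

/-- The Walsh–Kaczmarz function of index `n`; `Nat.log 2 n` is the order `|n|`. -/
def kacz (n : ℕ) (x : WG) : ℝ :=
  if n = 0 then 1 else
    rad (Nat.log 2 n) x *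
      (-1 : ℝ) ^ (∑ k ∈ Finset.range (Nat.log 2 n),
        (if n.testBit k then 1 else 0) * (x (Nat.log 2 n - 1 - k)).val)

/-- The `d`-dimensional Walsh–Kaczmarz function. -/
def kaczD (d : ℕ) (m : Fin d → ℕ) (x : Fin d → WG) : ℝ := ∏ i, kacz (m i) (x i)

/-- Walsh–Paley Dirichlet kernel. -/
def dirW (n : ℕ) (x : WG) : ℝ := ∑ k ∈ Finset.range n, walsh k x

/-- Walsh–Kaczmarz Dirichlet kernel. -/
def dirK (n : ℕ) (x : WG) : ℝ := ∑ k ∈ Finset.range n, kacz k x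

/-- `A_j^α = binom (j+α) j`. -/
def Abin (α : ℝ) (j : ℕ) : ℝ := ∏ i ∈ Finset.range j, (α + i + 1) / (i + 1)

/-- One-dimensional Walsh–Paley `(C,α)` kernel. -/
def KW (α : ℝ) (n : ℕ) (x : WG) : ℝ :=
  (Abin α n)⁻¹ * ∑ k ∈ Finset.range (n + 1), Abin (α - 1) (n - k) * dirW k x

/-- One-dimensional Walsh–Kaczmarz `(C,α)` kernel. -/
def KK (α : ℝ) (n : ℕ) (x : WG) : ℝ :=
  (Abin α n)⁻¹ * ∑ k ∈ Finset.range (n + 1), Abin (α - 1) (n - k) * dirK k x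

/-- The `m`-th Walsh–Kaczmarz–Fourier coefficient of `f : G^d → ℝ`. -/
def fCoeff (d : ℕ) (f : (Fin d → WG) → ℝ) (m : Fin d → ℕ) : ℝ :=
  ∫ x, f x * kaczD d m x ∂ μD d

/-- Rectangular partial sum built from an abstract family `c` of Fourier coefficients. -/
def partialSumOf (d : ℕ) (c : (Fin d → ℕ) → ℝ) (k : Fin d → ℕ) (x : Fin d → WG) : ℝ :=
  ∑ m ∈ Fintype.piFinset (fun i => Finset.range (k i)), c m * kaczD d m x

/-- `(C,α)` (Cesàro) mean of order `n` built from coefficients `c`. -/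
def cesaroOf (d : ℕ) (α : Fin d → ℝ) (c : (Fin d → ℕ) → ℝ) (n : Fin d → ℕ)
    (x : Fin d → WG) : ℝ :=
  (∏ i, Abin (α i) (n i))⁻¹ *
    ∑ k ∈ Fintype.piFinset (fun i => Finset.range (n i + 1)),
      (∏ i, Abin (α i - 1) (n i - k i)) * partialSumOf d c k x

/-- A cone-like restriction function (CRF) family `γ = (γ_j)_{j ≠ 0}`. -/
structure IsCRF (d : ℕ) [NeZero d] (γ : Fin d → ℝ → ℝ) : Prop where
  strictMono : ∀ j : Fin d, j ≠ 0 → StrictMonoOn (γ j) (Set.Ici 1)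
  contOn : ∀ j : Fin d, j ≠ 0 → ContinuousOn (γ j) (Set.Ici 1)
  one_le : ∀ j : Fin d, j ≠ 0 → ∀ x : ℝ, 1 ≤ x → 1 ≤ γ j x
  map_one : ∀ j : Fin d, j ≠ 0 → γ j 1 = 1
  tendsto_atTop : ∀ j : Fin d, j ≠ 0 → Tendsto (γ j) atTop atTop
  reg : ∃ ζ : ℝ, 1 < ζ ∧ ∀ j : Fin d, j ≠ 0 → ∃ c₁ c₂ : ℝ, 1 < c₁ ∧ 1 < c₂ ∧
    ∀ x : ℝ, 1 ≤ x → c₁ * γ j x ≤ γ j (ζ * x) ∧ γ j (ζ * x) ≤ c₂ * γ j x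

/-- The cone-like set `L` determined by `γ` and the parameters `β`. -/
def coneLike (d : ℕ) [NeZero d] (γ : Fin d → ℝ → ℝ) (β : Fin d → ℝ) : Set (Fin d → ℕ) :=
  {n | ∀ j : Fin d, j ≠ 0 → (β j)⁻¹ * γ j (n 0) ≤ (n j : ℝ) ∧ (n j : ℝ) ≤ β j * γ j (n 0)}

/-- `bar γ n₁ = (n₁, n₂, …, n_d)` where `n_j = |γ_j(2^{n₁})|` is the order of `γ_j(2^{n₁})`,
i.e. `2^{n_j} ≤ γ_j(2^{n₁}) < 2^{n_j+1}`. -/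
def bar (d : ℕ) [NeZero d] (γ : Fin d → ℝ → ℝ) (n₁ : ℕ) : Fin d → ℕ :=
  fun j => if j = 0 then n₁ else Nat.log 2 ⌊γ j ((2 : ℝ) ^ n₁)⌋₊

/-- The cone-like restricted maximal operator `σ_L^{κ,α,*}` (built from coefficients `c`). -/
def cesaroMaximal (d : ℕ) [NeZero d] (α : Fin d → ℝ) (γ : Fin d → ℝ → ℝ) (β : Fin d → ℝ)
    (c : (Fin d → ℕ) → ℝ) (x : Fin d → WG) : ℝ≥0∞ :=
  ⨆ n ∈ coneLike d γ β, ENNReal.ofReal |cesaroOf d α c n x|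

/-- `L^p`-"norm" (`0 < p < ∞`) of an `ℝ≥0∞`-valued function on `G^d`. -/
def lpNormE (d : ℕ) (p : ℝ) (g : (Fin d → WG) → ℝ≥0∞) : ℝ≥0∞ :=
  (∫⁻ x, g x ^ p ∂ μD d) ^ (1 / p)

/-- The dyadic rectangle `I_{N}(y) = I_{N_1}(y^1) × ⋯ × I_{N_d}(y^d)`. -/
def rectAt (d : ℕ) (N : Fin d → ℕ) (y : Fin d → WG) : Set (Fin d → WG) :=
  {x | ∀ j : Fin d, ∀ i : ℕ, i < N j → x j i = y j i}

/-- The one-dimensional dyadic interval `I_N = I_N(0)`. -/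
def rectW (N : ℕ) : Set WG := {x | ∀ i : ℕ, i < N → x i = 0}

/-- A one-parameter martingale with respect to the filtration
`(F_{bar γ n₁})_{n₁}` generated by the dyadic rectangles `I_{bar γ n₁}(y)`
(measurability w.r.t. this atomic σ-algebra = being constant on its rectangles,
and the martingale property = equality of integrals over the rectangles). -/
structure ConeMartingale (d : ℕ) [NeZero d] (γ : Fin d → ℝ → ℝ) where
  F : ℕ → (Fin d → WG) → ℝ
  integrable : ∀ n₁, Integrable (F n₁) (μD d)
  adapted : ∀ n₁ (x y : Fin d → WG),
    (∀ j : Fin d, ∀ i : ℕ, i < bar d γ n₁ j → x j i = y j i) → F n₁ x = F n₁ y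
  mart : ∀ n₁ m₁, n₁ ≤ m₁ → ∀ y,
    ∫ x in rectAt d (bar d γ n₁) y, F m₁ x ∂ μD d
      = ∫ x in rectAt d (bar d γ n₁) y, F n₁ x ∂ μD d

/-- The Fourier coefficients of a martingale (the integrals `∫ f_k ψ_m` stabilize). -/
def martCoeff (d : ℕ) [NeZero d] (γ : Fin d → ℝ → ℝ) (f : ConeMartingale d γ) (m : Fin d → ℕ) : ℝ :=
  limUnder atTop (fun k => ∫ x, f.F k x * kaczD d m x ∂ μD d)

/-- The maximal function `f* = sup_{n₁} |f_{bar n₁}|` of a martingale. -/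
def martMaximal (d : ℕ) [NeZero d] (γ : Fin d → ℝ → ℝ) (f : ConeMartingale d γ)
    (x : Fin d → WG) : ℝ≥0∞ :=
  ⨆ n₁ : ℕ, ENNReal.ofReal |f.F n₁ x|

/-- The martingale Hardy space "norm" `‖f‖_{H_p^γ} = ‖f*‖_p`. -/
def hardyNorm (d : ℕ) [NeZero d] (γ : Fin d → ℝ → ℝ) (p : ℝ) (f : ConeMartingale d γ) : ℝ≥0∞ :=
  lpNormE d p (martMaximal d γ f)

/-- A `p`-atom supported on the rectangle `I_N(y)`. -/
structure IsPAtom (d : ℕ) (p : ℝ) (a : (Fin d → WG) → ℝ) (N : Fin d → ℕ)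
    (y : Fin d → WG) : Prop where
  measurable : Measurable a
  support : ∀ x, x ∉ rectAt d N y → a x = 0
  bound : ∀ x, |a x| ≤ ((μD d (rectAt d N y)).toReal) ^ (-(1 / p))
  zero : ∫ x, a x ∂ μD d = 0

/-- The conditional-expectation (dyadic average) of `f` at level `N`. -/
def avgAt (d : ℕ) (N : Fin d → ℕ) (f : (Fin d → WG) → ℝ) (x : Fin d → WG) : ℝ :=
  (2 : ℝ) ^ (∑ j, N j) * ∫ t in rectAt d N x, f t ∂ μD d

/-- `m` is the martingale generated by the integrable function `f`. -/
def inducedLevels (d : ℕ) [NeZero d] (γ : Fin d → ℝ → ℝ) (f : (Fin d → WG) → ℝ)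
    (m : ConeMartingale d γ) : Prop :=
  ∀ n₁ x, m.F n₁ x = avgAt d (bar d γ n₁) f x

/-- The martingale maximal function of (the martingale generated by) a function `f`,
`f* = sup_{n₁} |S_{2^{bar γ n₁}} f|`. -/
def funMaximal (d : ℕ) [NeZero d] (γ : Fin d → ℝ → ℝ) (f : (Fin d → WG) → ℝ)
    (x : Fin d → WG) : ℝ≥0∞ :=
  ⨆ n₁ : ℕ, ENNReal.ofReal |partialSumOf d (fCoeff d f) (fun j => 2 ^ bar d γ n₁ j) x|

/-- The Hardy norm `‖f‖_{H_p^γ}` of (the martingale generated by) a function `f`. -/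
def funHardyNorm (d : ℕ) [NeZero d] (γ : Fin d → ℝ → ℝ) (p : ℝ) (f : (Fin d → WG) → ℝ) : ℝ≥0∞ :=
  lpNormE d p (funMaximal d γ f)

/-- Skvortsov's bit-reversal transformation `τ_A`. -/
def tau (A : ℕ) (x : WG) : WG := fun i => if i < A then x (A - 1 - i) else x i

end

noncomputable section

/-- The cylinder of all `x` vanishing on the coordinates in `S`. -/
def zeroCylinder (S : Finset ℕ) : Set WG := {x | ∀ i ∈ S, x i = 0}

lemma measurableSet_zeroCylinder (S : Finset ℕ) : MeasurableSet (zeroCylinder S) := by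
  have h : zeroCylinder S = ⋂ i ∈ S, (fun x : WG => x i) ⁻¹' {0} := by
    ext x; simp [zeroCylinder]
  rw [h]
  exact Finset.measurableSet_biInter S fun i _ =>
    measurable_pi_apply i (measurableSet_singleton 0)

instance : IsProbabilityMeasure μW := by
  constructor
  rw [← TopologicalSpace.PositiveCompacts.coe_top (α := WG)]
  exact Measure.addHaarMeasure_self

lemma μW_zeroCylinder (S : Finset ℕ) : μW (zeroCylinder S) = 2⁻¹ ^ S.card := by
  have : (μW).IsAddHaarMeasure := by unfold μW; infer_instance
  induction S using Finset.induction_on with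
  | empty => simp [zeroCylinder]
  | insert i S hi ih =>
    have h_union : zeroCylinder S = zeroCylinder (insert i S) ∪
        (fun x => Pi.single i 1 + x) ⁻¹' zeroCylinder (insert i S) := by
      ext x
      have h_ne : ∀ j ∈ S, j ≠ i := fun j hj h => hi (h ▸ hj)
      have h_zmod : ∀ a : ZMod 2, a = 0 ∨ 1 + a = 0 := by decide
      simp only [zeroCylinder, Set.mem_ofPred_eq, Set.mem_union, Set.mem_preimage,
        Finset.forall_mem_insert, Pi.add_apply, Pi.single_eq_same]
      have h_shift : (∀ j ∈ S, (Pi.single i 1 : WG) j + x j = 0) ↔ ∀ j ∈ S, x j = 0 :=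
        forall₂_congr fun j hj => by rw [Pi.single_eq_of_ne (h_ne j hj), zero_add]
      rw [h_shift]
      have := h_zmod (x i)
      tauto
    have h_disj : Disjoint (zeroCylinder (insert i S))
        ((fun x => Pi.single i 1 + x) ⁻¹' zeroCylinder (insert i S)) := by
      rw [Set.disjoint_left]
      intro x hx hx'
      have h₁ : x i = 0 := hx i (Finset.mem_insert_self i S)
      have h₂ : (Pi.single i 1 : WG) i + x i = 0 := hx' i (Finset.mem_insert_self i S)
      simp [h₁] at h₂
    have h_double : μW (zeroCylinder S) = 2 * μW (zeroCylinder (insert i S)) := by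
      rw [h_union, measure_union h_disj
        ((measurable_const_add _) (measurableSet_zeroCylinder _)), measure_preimage_add, two_mul]
    rw [Finset.card_insert_of_notMem hi, pow_succ, ← ih, h_double, mul_comm (2 : ℝ≥0∞), mul_assoc,
      ENNReal.mul_inv_cancel (by simp) (by simp), mul_one]

lemma iIndepSet_zeroCylinder {W : ℕ → Finset ℕ} (hW : Pairwise fun i j => Disjoint (W i) (W j)) :
    ProbabilityTheory.iIndepSet (fun j => zeroCylinder (W j)) μW := by
  rw [ProbabilityTheory.iIndepSet_iff_meas_biInter fun j => measurableSet_zeroCylinder _]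
  intro T
  have h : (⋂ j ∈ T, zeroCylinder (W j)) = zeroCylinder (T.biUnion W) := by
    ext x
    simp only [zeroCylinder, Set.mem_iInter, Set.mem_ofPred_eq, Finset.mem_biUnion]
    exact ⟨fun h i ⟨j, hj, hi⟩ => h j hj i hi, fun h j hj i hi => h i ⟨j, hj, hi⟩⟩
  rw [h, μW_zeroCylinder, Finset.card_biUnion fun i _ j _ hij => hW hij,
    ← Finset.prod_pow_eq_pow_sum]
  exact Finset.prod_congr rfl fun j _ => (μW_zeroCylinder _).symm

lemma sum_prod_testBit (a : ℕ → ℝ) (A : ℕ) :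
    ∑ j ∈ Finset.range (2 ^ A), ∏ k ∈ Finset.range A, (if j.testBit k then a k else 1) =
      ∏ k ∈ Finset.range A, (1 + a k) := by
  induction A with
  | zero => simp
  | succ A ih =>
    rw [pow_succ, mul_two, Finset.sum_range_add, Finset.prod_range_succ, ← ih, mul_add, mul_one,
      Finset.sum_mul]
    congr 1 <;> refine Finset.sum_congr rfl fun j hj => ?_
    · rw [Finset.prod_range_succ, Nat.testBit_lt_two_pow (Finset.mem_range.1 hj)]
      simp
    · rw [Finset.prod_range_succ, Nat.testBit_two_pow_add_eq,
        Nat.testBit_lt_two_pow (Finset.mem_range.1 hj)]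
      simp only [Bool.not_false, if_true]
      congr 1
      refine Finset.prod_congr rfl fun k hk => ?_
      rw [Nat.testBit_two_pow_add_gt (Finset.mem_range.1 hk)]

lemma log_two_pow_add {A j : ℕ} (hj : j < 2 ^ A) : Nat.log 2 (2 ^ A + j) = A :=
  (Nat.log_eq_iff (Or.inr ⟨by norm_num, by positivity⟩)).2 ⟨by omega, by rw [pow_succ]; omega⟩

lemma kacz_two_pow_add {A j : ℕ} (hj : j < 2 ^ A) (x : WG) :
    kacz (2 ^ A + j) x =
      rad A x * ∏ k ∈ Finset.range A, (if j.testBit k then rad (A - 1 - k) x else 1) := by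
  have h0 : 2 ^ A + j ≠ 0 := by positivity
  rw [kacz, if_neg h0, log_two_pow_add hj, ← Finset.prod_pow_eq_pow_sum]
  congr 1
  refine Finset.prod_congr rfl fun k hk => ?_
  rw [Nat.testBit_two_pow_add_gt (Finset.mem_range.1 hk)]
  split_ifs <;> simp [rad]

lemma dirK_two_pow (A : ℕ) (x : WG) :
    dirK (2 ^ A) x = ∏ k ∈ Finset.range A, (1 + rad k x) := by
  induction A with
  | zero => simp [dirK, kacz]
  | succ A ih =>
    have h_block : ∑ j ∈ Finset.range (2 ^ A), kacz (2 ^ A + j) x =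
        rad A x * ∏ k ∈ Finset.range A, (1 + rad k x) := by
      rw [Finset.sum_congr rfl fun j hj => kacz_two_pow_add (Finset.mem_range.1 hj) x,
        ← Finset.mul_sum, sum_prod_testBit (fun k => rad (A - 1 - k) x),
        Finset.prod_range_reflect (fun k => 1 + rad k x)]
    rw [dirK, pow_succ, mul_two, Finset.sum_range_add, h_block, Finset.prod_range_succ, ← ih, dirK]
    ring

lemma dirK_two_pow_nonneg (A : ℕ) (x : WG) : 0 ≤ dirK (2 ^ A) x := by
  rw [dirK_two_pow]
  refine Finset.prod_nonneg fun k _ => ?_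
  have h := neg_one_pow_eq_or ℝ (x k).val
  rw [rad]
  rcases h with h | h <;> rw [h] <;> norm_num

/-- A run of `s + 1` zeros ending at coordinate `A` makes a Dirichlet kernel of order `A` large. -/
lemma two_pow_le_dirK {A s : ℕ} (hs : s ≤ A) {x : WG} (hx : ∀ i, A - s ≤ i → i ≤ A → x i = 0) :
    (2 : ℝ) ^ s ≤ dirK (2 ^ A + 2 ^ s) x := by
  have h_one : ∀ j ∈ Finset.range (2 ^ s), kacz (2 ^ A + j) x = 1 := by
    intro j hj
    have hj := Finset.mem_range.1 hj
    rw [kacz_two_pow_add (hj.trans_le (Nat.pow_le_pow_right two_pos hs)),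
      Finset.prod_eq_one, mul_one, rad, hx A (by omega) le_rfl]
    · simp
    · intro k hk
      have hk := Finset.mem_range.1 hk
      split_ifs with hb
      · have hks : k < s := by
          by_contra! h
          rw [Nat.testBit_lt_two_pow (hj.trans_le (Nat.pow_le_pow_right two_pos h))] at hb
          exact absurd hb (by simp)
        rw [rad, hx _ (by omega) (by omega)]
        simp
      · rfl
  rw [dirK, Finset.sum_range_add, Finset.sum_congr rfl h_one]
  have := dirK_two_pow_nonneg A x
  rw [dirK] at this
  simp [this]

/-- Run lengths, of size about `log₂ (j log₂ j)`. -/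
def runLength (j : ℕ) : ℕ := Nat.log 2 (j * (Nat.log 2 j + 1))

lemma runLength_mono : Monotone runLength := fun _ _ hij =>
  Nat.log_mono_right (Nat.mul_le_mul hij (Nat.succ_le_succ (Nat.log_mono_right hij)))

lemma two_pow_runLength_le {j : ℕ} (hj : j ≠ 0) :
    2 ^ runLength j ≤ j * (Nat.log 2 j + 1) :=
  Nat.pow_log_le_self 2 (by positivity)

lemma one_le_runLength {j : ℕ} (hj : 2 ≤ j) : 1 ≤ runLength j :=
  Nat.log_pos (by norm_num) (hj.trans (Nat.le_mul_of_pos_right j (Nat.succ_pos _)))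

lemma succ_mul_runLength_le {j : ℕ} (hj : 2 ≤ j) :
    (j + 1) * runLength j ≤ 8 * 2 ^ runLength j := by
  have h_lt : j < 2 ^ (Nat.log 2 j + 1) := Nat.lt_pow_succ_log_self (by norm_num) j
  have h_log : Nat.log 2 j + 1 ≤ j := Nat.log_lt_self 2 (by omega)
  have h_len : runLength j ≤ 2 * (Nat.log 2 j + 1) := by
    refine (Nat.log_lt_of_lt_pow (by positivity) ?_).le
    calc j * (Nat.log 2 j + 1) ≤ j * j := Nat.mul_le_mul_left j h_log
      _ < 2 ^ (Nat.log 2 j + 1) * 2 ^ (Nat.log 2 j + 1) := Nat.mul_lt_mul'' h_lt h_lt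
      _ = 2 ^ (2 * (Nat.log 2 j + 1)) := by rw [← pow_add, two_mul]
  have h_up : j * (Nat.log 2 j + 1) < 2 ^ (runLength j + 1) :=
    Nat.lt_pow_succ_log_self (by norm_num) _
  rw [pow_succ] at h_up
  calc (j + 1) * runLength j ≤ (2 * j) * (2 * (Nat.log 2 j + 1)) :=
        Nat.mul_le_mul (by omega) h_len
    _ = 4 * (j * (Nat.log 2 j + 1)) := by ring
    _ ≤ 8 * 2 ^ runLength j := by omega

lemma not_summable_inv_mul_log :
    ¬ Summable fun j : ℕ => ((j * (Nat.log 2 j + 1) : ℕ) : ℝ)⁻¹ := by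
  rw [← summable_condensed_iff_of_nonneg (fun j => by positivity)]
  · have h : (fun k : ℕ => (2 : ℝ) ^ k * ((2 ^ k * (Nat.log 2 (2 ^ k) + 1) : ℕ) : ℝ)⁻¹) =
        fun k : ℕ => (((k + 1 : ℕ) : ℝ))⁻¹ := by
      funext k
      rw [Nat.log_pow (by norm_num)]
      push_cast
      field_simp
    rw [h, summable_nat_add_iff 1 (f := fun k : ℕ => (k : ℝ)⁻¹)]
    exact Real.not_summable_natCast_inv
  · intro m n hm hmn
    refine inv_anti₀ (by positivity) ?_
    exact_mod_cast Nat.mul_le_mul hmn (Nat.succ_le_succ (Nat.log_mono_right hmn))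

lemma tsum_two_inv_pow_runLength : ∑' j, (2⁻¹ : ℝ≥0∞) ^ runLength j = ⊤ := by
  by_contra h
  refine not_summable_inv_mul_log ((ENNReal.summable_toReal h).of_nonneg_of_le
    (fun j => by positivity) fun j => ?_)
  rcases eq_or_ne j 0 with rfl | hj
  · simp
  rw [ENNReal.toReal_pow, ENNReal.toReal_inv, ENNReal.toReal_ofNat, inv_pow]
  refine inv_anti₀ (by positivity) ?_
  exact_mod_cast two_pow_runLength_le hj

/-- Disjoint windows of coordinates: the `j`-th one has `runLength j` elements. -/
def window (j : ℕ) : Finset ℕ := Finset.Ico (j * runLength j) ((j + 1) * runLength j)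

lemma card_window (j : ℕ) : (window j).card = runLength j := by
  simp [window, add_mul]

lemma pairwise_disjoint_window : Pairwise fun i j => Disjoint (window i) (window j) := by
  refine (pairwise_disjoint_on window).2 fun i j hij => ?_
  have h : (i + 1) * runLength i ≤ j * runLength j :=
    Nat.mul_le_mul hij (runLength_mono hij.le)
  rw [window, window, Finset.disjoint_left]
  intro a ha hb
  rw [Finset.mem_Ico] at ha hb
  omega

lemma ae_frequently_zero_on_window : ∀ᵐ x ∂μW, ∃ᶠ j in atTop, x ∈ zeroCylinder (window j) := by
  have h := ProbabilityTheory.measure_limsup_eq_one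
    (fun j => measurableSet_zeroCylinder (window j))
    (iIndepSet_zeroCylinder pairwise_disjoint_window)
    (by simp_rw [μW_zeroCylinder, card_window]; exact tsum_two_inv_pow_runLength)
  filter_upwards [(mem_ae_iff_prob_eq_one
    (MeasurableSet.measurableSet_limsup fun j => measurableSet_zeroCylinder (window j))).2 h]
    with x hx
  rwa [Filter.mem_limsup_iff_frequently_mem] at hx

lemma exists_le_dirK_div_log {j : ℕ} (hj : 2 ≤ j) {x : WG} (hx : x ∈ zeroCylinder (window j)) :
    ∃ n ≥ j, 1 / 16 ≤ dirK n x / Real.log n := by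
  obtain ⟨s, hs⟩ : ∃ s, runLength j = s + 1 :=
    ⟨runLength j - 1, by have := one_le_runLength hj; omega⟩
  obtain ⟨A, hA⟩ : ∃ A, (j + 1) * runLength j = A + 1 :=
    ⟨(j + 1) * runLength j - 1, by
      have : 0 < (j + 1) * runLength j := Nat.mul_pos (by omega) (one_le_runLength hj)
      omega⟩
  have hsA : A + 1 = j * runLength j + (s + 1) := by rw [← hA, ← hs]; ring
  have hjA : j + 1 ≤ A + 1 := hA ▸ Nat.le_mul_of_pos_right _ (one_le_runLength hj)
  have h_bound : A + 1 ≤ 16 * 2 ^ s := by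
    have := succ_mul_runLength_le hj
    rw [hA, hs, pow_succ] at this
    omega
  have h_dir : (2 : ℝ) ^ s ≤ dirK (2 ^ A + 2 ^ s) x := by
    refine two_pow_le_dirK (by omega) fun i hi hi' => hx i ?_
    rw [window, Finset.mem_Ico]
    omega
  have h_pow : A < 2 ^ A := Nat.lt_two_pow_self
  have h_pos : 0 < 2 ^ s := by positivity
  refine ⟨2 ^ A + 2 ^ s, by omega, ?_⟩
  have h_log_pos : 0 < Real.log ((2 ^ A + 2 ^ s : ℕ) : ℝ) := by
    refine Real.log_pos ?_
    exact_mod_cast (by omega : 1 < 2 ^ A + 2 ^ s)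
  have h_log : Real.log ((2 ^ A + 2 ^ s : ℕ) : ℝ) ≤ A + 1 := by
    have h_le : 2 ^ A + 2 ^ s ≤ 2 ^ (A + 1) := by
      have : 2 ^ s ≤ 2 ^ A := Nat.pow_le_pow_right two_pos (by omega)
      rw [pow_succ]
      omega
    calc Real.log ((2 ^ A + 2 ^ s : ℕ) : ℝ) ≤ Real.log ((2 ^ (A + 1) : ℕ) : ℝ) :=
          Real.log_le_log (by positivity) (by exact_mod_cast h_le)
      _ = (A + 1) * Real.log 2 := by push_cast; rw [Real.log_pow]; push_cast; ring
      _ ≤ A + 1 := mul_le_of_le_one_right (by positivity) (by linarith [Real.log_two_lt_d9])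
  have h_bound' : (A : ℝ) + 1 ≤ 16 * 2 ^ s := by exact_mod_cast h_bound
  rw [le_div_iff₀ h_log_pos]
  linarith

/-- Šneider: there is `C > 0` such that
`limsup_n D_n^κ(x)/log n ≥ C` for almost every `x ∈ G`. -/
theorem sneider_limsup_dirK :
    ∃ C : ℝ, 0 < C ∧ ∀ᵐ x ∂ μW,
      ENNReal.ofReal C ≤
        Filter.limsup (fun n : ℕ => ENNReal.ofReal (dirK n x / Real.log n)) atTop := by
  refine ⟨1 / 16, by norm_num, ?_⟩
  filter_upwards [ae_frequently_zero_on_window] with x hx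
  refine Filter.le_limsup_of_frequently_le ?_
  rw [Filter.frequently_atTop] at hx ⊢
  intro N
  obtain ⟨j, hj, hxj⟩ := hx (max N 2)
  obtain ⟨n, hn, h⟩ := exists_le_dirK_div_log (by omega) hxj
  exact ⟨n, by omega, ENNReal.ofReal_le_ofReal h⟩

end
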